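/- arXiv:math/0602138 — 8 statements merged into one kernel-verified Lean document; each statement's English description precedes it below -/
import Mathlib

section
/- Let R be a commutative ring, X a type, and π a biderivation on the free algebra FreeAlgebra R X. Let J be the two-sided ideal of FreeAlgebra R X generated by the elements ι(x)·ι(y) − ι(y)·ι(x) − π(ι(x), ι(y)) for x, y ∈ X. Then for all f, g ∈ FreeAlgebra R X, the element f·g − g·f − π(f,g) lies in J. -/
/-- A biderivation on an associative unital `R`-algebra `A`: an `R`-bilinear map
`π : A → A → A` such that `π (a*b) c = a * π b c + π a c * b` and
`π a (b*c) = b * π a c + π a b * c`. -/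
def IsBiderivation {R A : Type*} [CommRing R] [Ring A] [Algebra R A]
    (π : A →ₗ[R] A →ₗ[R] A) : Prop :=
  (∀ a b c : A, π (a * b) c = a * π b c + π a c * b) ∧
  (∀ a b c : A, π a (b * c) = b * π a c + π a b * c)

/-- A biderivation vanishes on scalars on the left. -/
theorem IsBiderivation.algebraMap_left {R A : Type*} [CommRing R] [Ring A] [Algebra R A]
    {π : A →ₗ[R] A →ₗ[R] A} (hπ : IsBiderivation π) (r : R) (c : A) :
    π (algebraMap R A r) c = 0 := by
  have h : π 1 c = 0 := by simpa using hπ.1 1 1 c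
  rw [Algebra.algebraMap_eq_smul_one, map_smul, LinearMap.smul_apply, h, smul_zero]

/-- A biderivation vanishes on scalars on the right. -/
theorem IsBiderivation.algebraMap_right {R A : Type*} [CommRing R] [Ring A] [Algebra R A]
    {π : A →ₗ[R] A →ₗ[R] A} (hπ : IsBiderivation π) (r : R) (a : A) :
    π a (algebraMap R A r) = 0 := by
  have h : π a 1 = 0 := by simpa using hπ.2 a 1 1
  rw [Algebra.algebraMap_eq_smul_one, map_smul, h, smul_zero]

/-- If the defect `a * b - b * a - π a b` of a biderivation on a free algebra lies in a two-sided
ideal for all pairs of generators, then it does so for all pairs of elements. -/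
theorem IsBiderivation.commutator_sub_mem {R X : Type*} [CommRing R]
    {π : FreeAlgebra R X →ₗ[R] FreeAlgebra R X →ₗ[R] FreeAlgebra R X} (hπ : IsBiderivation π)
    (J : TwoSidedIdeal (FreeAlgebra R X))
    (hJ : ∀ x y : X, FreeAlgebra.ι R x * FreeAlgebra.ι R y - FreeAlgebra.ι R y * FreeAlgebra.ι R x
      - π (FreeAlgebra.ι R x) (FreeAlgebra.ι R y) ∈ J)
    (f g : FreeAlgebra R X) : f * g - g * f - π f g ∈ J := by
  induction f using FreeAlgebra.induction with
  | grade0 r => simp [hπ.algebraMap_left, Algebra.commutes r g, J.zero_mem]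
  | grade1 x =>
    induction g using FreeAlgebra.induction with
    | grade0 r =>
      simp [hπ.algebraMap_right, Algebra.commutes r (FreeAlgebra.ι R x), J.zero_mem]
    | grade1 y => exact hJ x y
    | mul a b ha hb =>
      convert J.add_mem (J.mul_mem_left a _ hb) (J.mul_mem_right _ b ha) using 1
      rw [hπ.2]
      noncomm_ring
    | add a b ha hb =>
      convert J.add_mem ha hb using 1
      rw [map_add]
      noncomm_ring
  | mul a b ha hb =>
    convert J.add_mem (J.mul_mem_left a _ hb) (J.mul_mem_right _ b ha) using 1
    rw [hπ.1]
    noncomm_ring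
  | add a b ha hb =>
    convert J.add_mem ha hb using 1
    rw [map_add, LinearMap.add_apply]
    noncomm_ring

/-- If `π` is a biderivation on `FreeAlgebra R X` and `J` is the two-sided
ideal generated by the elements `ι x * ι y − ι y * ι x − π (ι x) (ι y)` for `x y : X`,
then `f*g − g*f − π f g ∈ J` for all `f g : FreeAlgebra R X`. -/
theorem commutator_defects_lie_in_generator_ideal
    (R : Type*) [CommRing R] (X : Type*)
    (π : FreeAlgebra R X →ₗ[R] FreeAlgebra R X →ₗ[R] FreeAlgebra R X)
    (hπ : IsBiderivation π) :
    ∀ f g : FreeAlgebra R X,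
      f * g - g * f - π f g ∈
        TwoSidedIdeal.span {z : FreeAlgebra R X | ∃ x y : X,
          z = FreeAlgebra.ι R x * FreeAlgebra.ι R y - FreeAlgebra.ι R y * FreeAlgebra.ι R x
              - π (FreeAlgebra.ι R x) (FreeAlgebra.ι R y)} := by
  exact hπ.commutator_sub_mem _ fun x y => TwoSidedIdeal.subset_span ⟨x, y, rfl⟩
end

section
/- Let R be a commutative ring, X a type, and π a biderivation on FreeAlgebra R X. Then the two-sided ideal of FreeAlgebra R X generated by all elements f·g − g·f − π(f,g) with f, g ∈ FreeAlgebra R X is equal to the two-sided ideal generated by the elements ι(x)·ι(y) − ι(y)·ι(x) − π(ι(x), ι(y)) with x, y ∈ X. -/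
namespace IsBiderivation

variable {R A : Type*} [CommRing R] [Ring A] [Algebra R A] {π : A →ₗ[R] A →ₗ[R] A}

theorem algebraMap_left_s5 (hπ : IsBiderivation π) (r : R) (c : A) : π (algebraMap R A r) c = 0 := by
  have h : π 1 c = 0 := by simpa using hπ.1 1 1 c
  rw [Algebra.algebraMap_eq_smul_one, map_smul, LinearMap.smul_apply, h, smul_zero]

theorem algebraMap_right_s5 (hπ : IsBiderivation π) (a : A) (r : R) : π a (algebraMap R A r) = 0 := by
  have h : π a 1 = 0 := by simpa using hπ.2 a 1 1
  rw [Algebra.algebraMap_eq_smul_one, map_smul, h, smul_zero]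

/-- The elements `f` with `f * g - g * f - π f g ∈ I` form a subalgebra. -/
def leftSubalgebra (hπ : IsBiderivation π) (I : TwoSidedIdeal A) (g : A) : Subalgebra R A where
  carrier := {f | f * g - g * f - π f g ∈ I}
  algebraMap_mem' r := by
    simp [hπ.algebraMap_left_s5, Algebra.commutes r g, I.zero_mem]
  add_mem' {a b} ha hb := by
    have h : (a + b) * g - g * (a + b) - π (a + b) g =
        (a * g - g * a - π a g) + (b * g - g * b - π b g) := by
      rw [map_add, LinearMap.add_apply]; noncomm_ring
    exact Set.mem_ofPred.2 (h ▸ I.add_mem ha hb)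
  mul_mem' {a b} ha hb := by
    have h : a * b * g - g * (a * b) - π (a * b) g =
        a * (b * g - g * b - π b g) + (a * g - g * a - π a g) * b := by
      rw [hπ.1]; noncomm_ring
    exact Set.mem_ofPred.2 (h ▸ I.add_mem (I.mul_mem_left _ _ hb) (I.mul_mem_right _ _ ha))

/-- The elements `g` with `f * g - g * f - π f g ∈ I` form a subalgebra. -/
def rightSubalgebra (hπ : IsBiderivation π) (I : TwoSidedIdeal A) (f : A) : Subalgebra R A where
  carrier := {g | f * g - g * f - π f g ∈ I}
  algebraMap_mem' r := by
    simp [hπ.algebraMap_right_s5, Algebra.commutes r f, I.zero_mem]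
  add_mem' {a b} ha hb := by
    have h : f * (a + b) - (a + b) * f - π f (a + b) =
        (f * a - a * f - π f a) + (f * b - b * f - π f b) := by
      rw [map_add]; noncomm_ring
    exact Set.mem_ofPred.2 (h ▸ I.add_mem ha hb)
  mul_mem' {a b} ha hb := by
    have h : f * (a * b) - a * b * f - π f (a * b) =
        a * (f * b - b * f - π f b) + (f * a - a * f - π f a) * b := by
      rw [hπ.2]; noncomm_ring
    exact Set.mem_ofPred.2 (h ▸ I.add_mem (I.mul_mem_left _ _ hb) (I.mul_mem_right _ _ ha))

theorem commutator_sub_mem_of_adjoin_eq_top (hπ : IsBiderivation π) (I : TwoSidedIdeal A)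
    {s : Set A} (hs : Algebra.adjoin R s = ⊤)
    (h : ∀ x ∈ s, ∀ y ∈ s, x * y - y * x - π x y ∈ I) (f g : A) :
    f * g - g * f - π f g ∈ I := by
  have hright (x : A) (hx : x ∈ s) : g ∈ hπ.rightSubalgebra I x :=
    Algebra.adjoin_le (S := hπ.rightSubalgebra I x) (h x hx) (hs ▸ Algebra.mem_top)
  have hleft : f ∈ hπ.leftSubalgebra I g :=
    Algebra.adjoin_le (S := hπ.leftSubalgebra I g) hright (hs ▸ Algebra.mem_top)
  exact hleft

end IsBiderivation

/-- For a biderivation `π` on `FreeAlgebra R X`, the two-sided ideal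
generated by all `f*g − g*f − π f g` (`f g : FreeAlgebra R X`) equals the two-sided
ideal generated by the elements `ι x * ι y − ι y * ι x − π (ι x) (ι y)` (`x y : X`). -/
theorem commutator_ideal_eq_generator_ideal
    (R : Type*) [CommRing R] (X : Type*)
    (π : FreeAlgebra R X →ₗ[R] FreeAlgebra R X →ₗ[R] FreeAlgebra R X)
    (hπ : IsBiderivation π) :
    TwoSidedIdeal.span {z : FreeAlgebra R X | ∃ f g : FreeAlgebra R X,
        z = f * g - g * f - π f g} =
    TwoSidedIdeal.span {z : FreeAlgebra R X | ∃ x y : X,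
        z = FreeAlgebra.ι R x * FreeAlgebra.ι R y - FreeAlgebra.ι R y * FreeAlgebra.ι R x
            - π (FreeAlgebra.ι R x) (FreeAlgebra.ι R y)} := by
  apply le_antisymm <;> rw [TwoSidedIdeal.span_le]
  · rintro _ ⟨f, g, rfl⟩
    refine hπ.commutator_sub_mem_of_adjoin_eq_top _ (FreeAlgebra.adjoin_range_ι R X) ?_ f g
    rintro _ ⟨x, rfl⟩ _ ⟨y, rfl⟩
    exact TwoSidedIdeal.subset_span ⟨x, y, rfl⟩
  · rintro _ ⟨x, y, rfl⟩
    exact TwoSidedIdeal.subset_span ⟨_, _, rfl⟩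
end

section
/- Let R be a commutative ring and I a type, and for each i ∈ I let X_i be a type. Let T := FreeAlgebra R (Σ i, X_i) / ℛ, where ℛ is the two-sided ideal generated by all commutators of pairs of generators from the same block X_i, and for each i let ι_i : MvPolynomial X_i R → T be the R-algebra homomorphism sending each variable x ∈ X_i to the image of the generator (i,x). Then (T, (ι_i)) is the coproduct of the family of R-algebras MvPolynomial X_i R in the category of associative unital R-algebras: for every associative unital R-algebra B and every family of R-algebra homomorphisms φ_i : MvPolynomial X_i R → B there exists a unique R-algebra homomorphism ψ : T → B with ψ ∘ ι_i = φ_i for all i ∈ I. -/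
/-- The relation on `FreeAlgebra R (Σ i, X i)` identifying `ι⟨i,x⟩ * ι⟨i,y⟩` with
`ι⟨i,y⟩ * ι⟨i,x⟩` for generators in the same block; its `RingQuot` is the splay algebra,
the quotient by the two-sided ideal `ℛ` generated by same-block commutators. -/
def splayRel (R : Type*) [CommRing R] {I : Type*} (X : I → Type*) :
    FreeAlgebra R (Σ i, X i) → FreeAlgebra R (Σ i, X i) → Prop := fun a b =>
  ∃ (i : I) (x y : X i),
    a = FreeAlgebra.ι R (⟨i, x⟩ : Σ i, X i) * FreeAlgebra.ι R (⟨i, y⟩ : Σ i, X i) ∧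
    b = FreeAlgebra.ι R (⟨i, y⟩ : Σ i, X i) * FreeAlgebra.ι R (⟨i, x⟩ : Σ i, X i)

/-- The splay algebra of the free commutative coordinate algebras `R[X i]`. -/
abbrev Splay (R : Type*) [CommRing R] {I : Type*} (X : I → Type*) : Type _ :=
  RingQuot (splayRel R X)

open scoped IsMulCommutative in
/-- The algebra homomorphism from a polynomial algebra to a possibly noncommutative algebra
determined by a family of pairwise commuting elements. -/
noncomputable def MvPolynomial.aevalOfCommute {R σ A : Type*} [CommSemiring R] [Semiring A]
    [Algebra R A] (f : σ → A) (hf : ∀ x y, Commute (f x) (f y)) : MvPolynomial σ R →ₐ[R] A :=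
  haveI : IsMulCommutative (Algebra.adjoin R (Set.range f)) :=
    Algebra.isMulCommutative_adjoin R (by
      rintro _ ⟨x, rfl⟩ _ ⟨y, rfl⟩
      exact hf x y)
  (Algebra.adjoin R (Set.range f)).val.comp
    (MvPolynomial.aeval fun x => ⟨f x, Algebra.subset_adjoin ⟨x, rfl⟩⟩)

theorem MvPolynomial.aevalOfCommute_X {R σ A : Type*} [CommSemiring R] [Semiring A] [Algebra R A]
    (f : σ → A) (hf : ∀ x y, Commute (f x) (f y)) (x : σ) :
    MvPolynomial.aevalOfCommute (R := R) f hf (MvPolynomial.X x) = f x := by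
  simp [MvPolynomial.aevalOfCommute]

theorem Splay.commute_mkAlgHom_ι (R : Type*) [CommRing R] {I : Type*} (X : I → Type*)
    (i : I) (x y : X i) :
    Commute (RingQuot.mkAlgHom R (splayRel R X) (FreeAlgebra.ι R (⟨i, x⟩ : Σ i, X i)))
      (RingQuot.mkAlgHom R (splayRel R X) (FreeAlgebra.ι R (⟨i, y⟩ : Σ i, X i))) := by
  rw [Commute, SemiconjBy, ← map_mul, ← map_mul]
  exact RingQuot.mkAlgHom_rel R ⟨i, x, y, rfl, rfl⟩

/-- The splay algebra `T`, together with the canonical maps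
`ι_i : MvPolynomial (X i) R → T` (sending each variable `x : X i` to the image of the
generator `(i,x)`), is the coproduct of the family `MvPolynomial (X i) R` in the
category of associative unital `R`-algebras. -/
theorem splay_is_coproduct_of_polynomial_algebras
    (R : Type*) [CommRing R] (I : Type*) (X : I → Type*) :
    ∃ ιi : ∀ i : I, MvPolynomial (X i) R →ₐ[R] Splay R X,
      (∀ (i : I) (x : X i),
        ιi i (MvPolynomial.X x) =
          RingQuot.mkAlgHom R (splayRel R X) (FreeAlgebra.ι R (⟨i, x⟩ : Σ i, X i))) ∧
      ∀ (B : Type*) [Ring B] [Algebra R B] (φ : ∀ i : I, MvPolynomial (X i) R →ₐ[R] B),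
        ∃! ψ : Splay R X →ₐ[R] B, ∀ i : I, ψ.comp (ιi i) = φ i := by
  refine ⟨fun i => MvPolynomial.aevalOfCommute _ (Splay.commute_mkAlgHom_ι R X i),
    fun i x => MvPolynomial.aevalOfCommute_X _ _ x, ?_⟩
  intro B _ _ φ
  let g : (Σ i, X i) → B := fun p => φ p.1 (MvPolynomial.X p.2)
  have hg : ∀ ⦃a b⦄, splayRel R X a b → FreeAlgebra.lift R g a = FreeAlgebra.lift R g b := by
    rintro _ _ ⟨i, x, y, rfl, rfl⟩
    simp only [map_mul, FreeAlgebra.lift_ι_apply, g]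
    rw [← map_mul, mul_comm, map_mul]
  refine ⟨RingQuot.liftAlgHom R ⟨FreeAlgebra.lift R g, hg⟩, ?_, ?_⟩
  · intro i
    refine MvPolynomial.algHom_ext fun x => ?_
    rw [AlgHom.comp_apply, MvPolynomial.aevalOfCommute_X, RingQuot.liftAlgHom_mkAlgHom_apply,
      FreeAlgebra.lift_ι_apply]
  · intro ψ hψ
    refine RingQuot.ringQuot_ext' _ _ _ (FreeAlgebra.hom_ext (funext fun ⟨i, x⟩ => ?_))
    have h := DFunLike.congr_fun (hψ i) (MvPolynomial.X x)
    rw [AlgHom.comp_apply, MvPolynomial.aevalOfCommute_X] at h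
    simp only [Function.comp_apply, AlgHom.comp_apply, RingQuot.liftAlgHom_mkAlgHom_apply,
      FreeAlgebra.lift_ι_apply]
    exact h
end

section
/- Let p be a prime and n a natural number with base-p digits n_t (so n = Σ_t n_t·p^t with 0 ≤ n_t < p for all t, almost all zero). Then N := n! / ∏_t ((p^t)!)^{n_t} is an integer, and N ≡ ∏_t n_t! (mod p). -/
theorem Nat.choose_add_prime_pow_mul_modEq {p : ℕ} (hp : p.Prime) {a r : ℕ} (hr : r < p ^ a)
    (d : ℕ) : (r + p ^ a * d).choose (p ^ a) ≡ d [MOD p] := by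
  have := Fact.mk hp
  have hpos : 0 < p ^ a := pow_pos hp.pos a
  have h := Choose.choose_modEq_choose_mul_prod_range_choose
    (n := r + p ^ a * d) (k := p ^ a) (p := p) a
  rw [Nat.add_mul_div_left _ _ hpos, Nat.div_eq_of_lt hr, zero_add, Nat.div_self hpos,
    Nat.choose_one_right, Finset.prod_eq_one, Nat.cast_one, mul_one] at h
  · exact (Int.natCast_modEq_iff).1 h
  · intro i hi
    have hi' : i < a := Finset.mem_range.1 hi
    have hdvd : p ∣ p ^ a / p ^ i := by
      rw [Nat.pow_div hi'.le hp.pos]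
      exact dvd_pow_self p (by omega)
    simp [Nat.mod_eq_zero_of_dvd hdvd]

theorem Nat.exists_factorial_add_prime_pow_mul {p : ℕ} (hp : p.Prime) {a r : ℕ} (hr : r < p ^ a)
    (d : ℕ) : ∃ N, (r + p ^ a * d).factorial = N * (r.factorial * (p ^ a).factorial ^ d) ∧
      N ≡ d.factorial [MOD p] := by
  induction d with
  | zero => exact ⟨1, by simp, rfl⟩
  | succ d ih =>
    obtain ⟨N, hN, hmod⟩ := ih
    refine ⟨(r + p ^ a * (d + 1)).choose (p ^ a) * N, ?_, ?_⟩
    · have h := Nat.add_choose_mul_factorial_mul_factorial (r + p ^ a * d) (p ^ a)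
      rw [hN, add_assoc, ← Nat.mul_succ] at h
      rw [← h]
      ring
    · rw [Nat.factorial_succ]
      exact (Nat.choose_add_prime_pow_mul_modEq hp hr (d + 1)).mul hmod

theorem Nat.exists_factorial_mod_prime_pow {p : ℕ} (hp : p.Prime) (n T : ℕ) :
    ∃ N, (n % p ^ T).factorial =
        N * ∏ t ∈ Finset.range T, (p ^ t).factorial ^ (n / p ^ t % p) ∧
      N ≡ ∏ t ∈ Finset.range T, (n / p ^ t % p).factorial [MOD p] := by
  induction T with
  | zero => exact ⟨1, by simp [Nat.mod_one], by simp; rfl⟩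
  | succ T ih =>
    obtain ⟨N, hN, hmod⟩ := ih
    obtain ⟨M, hM, hMmod⟩ := Nat.exists_factorial_add_prime_pow_mul hp
      (Nat.mod_lt n (pow_pos hp.pos T)) (n / p ^ T % p)
    refine ⟨N * M, ?_, ?_⟩
    · rw [Nat.mod_pow_succ, hM, hN, Finset.prod_range_succ]
      ring
    · rw [Finset.prod_range_succ]
      exact hmod.mul hMmod


/-- For a prime `p` and `n : ℕ` with base-`p` digits `n_t = (n / p^t) % p`,
the number `N := n! / ∏_t ((p^t)!)^{n_t}` is an integer (i.e. the product divides `n!`),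
and `N ≡ ∏_t n_t!  (mod p)`.  All digits with `t > n` vanish, so the products over
`Finset.range (n+1)` include every nonzero factor. -/
theorem multiplicative_basis_coefficient_integral_and_congruent
    (p : ℕ) (hp : p.Prime) (n : ℕ) :
    (∏ t ∈ Finset.range (n + 1), ((p ^ t).factorial) ^ ((n / p ^ t) % p)) ∣ n.factorial ∧
    Nat.ModEq p
      (n.factorial / ∏ t ∈ Finset.range (n + 1), ((p ^ t).factorial) ^ ((n / p ^ t) % p))
      (∏ t ∈ Finset.range (n + 1), ((n / p ^ t) % p).factorial) := by
  have hlt : n < p ^ (n + 1) := (Nat.lt_succ_self n).trans (Nat.lt_pow_self hp.one_lt)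
  obtain ⟨N, hN, hmod⟩ := Nat.exists_factorial_mod_prime_pow hp n (n + 1)
  rw [Nat.mod_eq_of_lt hlt] at hN
  refine ⟨Dvd.intro_left N hN.symm, ?_⟩
  rwa [hN, Nat.mul_div_cancel _ (Finset.prod_pos fun t _ => pow_pos (Nat.factorial_pos _) _)]
end

section
/- Let p be a prime, m a natural number with base-p digits m_t (so m = Σ_t m_t p^t, 0 ≤ m_t < p), and a any natural number. Then, as a congruence of integers, (∏_t m_t!) · C(a, m) ≡ ∏_t ∏_{s=0}^{m_t−1} ( C(a, p^t) − s ) (mod p), where C(·,·) denotes the binomial coefficient and both products are finite (taken over the t with m_t > 0). -/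
/-- The base-`p` form of Lucas's theorem at a power of `p`: `C(a, p ^ t)` is congruent modulo `p`
to the `t`-th base-`p` digit of `a`. -/
theorem choose_prime_pow_modEq_digit {p : ℕ} [Fact p.Prime] (a t : ℕ) :
    (a.choose (p ^ t) : ℤ) ≡ ((a / p ^ t % p : ℕ) : ℤ) [ZMOD p] := by
  have hp : p.Prime := Fact.out
  have lower_digits : ∀ i ∈ Finset.range t, (a / p ^ i % p).choose (p ^ t / p ^ i % p) = 1 := by
    intro i hi
    have hi : i < t := Finset.mem_range.mp hi
    rw [Nat.pow_div hi.le hp.pos, Nat.mod_eq_zero_of_dvd (dvd_pow_self p (by lia)),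
      Nat.choose_zero_right]
  have lucas := Choose.choose_modEq_choose_mul_prod_range_choose (n := a) (k := p ^ t) (p := p) t
  rw [Finset.prod_eq_one lower_digits, Nat.div_self (pow_pos hp.pos t),
    Nat.choose_one_right, Nat.cast_one, mul_one] at lucas
  exact lucas.trans (by push_cast; exact (Int.mod_modEq _ _).symm)

theorem factorial_mul_choose_eq_prod_range_sub (n k : ℕ) :
    (k.factorial * n.choose k : ℤ) = ∏ s ∈ Finset.range k, ((n : ℤ) - s) := by
  rw [← descPochhammer_eval_eq_prod_range, descPochhammer_eval_eq_descFactorial,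
    Nat.descFactorial_eq_factorial_mul_choose, Nat.cast_mul]


/-- For a prime `p`, `m : ℕ` with base-`p` digits `m_t = (m / p^t) % p`,
and any `a : ℕ`, one has the integer congruence
`(∏_t m_t!) · C(a,m) ≡ ∏_t ∏_{s=0}^{m_t-1} (C(a,p^t) − s)  (mod p)`.
Digits with `t > m` vanish and contribute trivial factors, so products over
`Finset.range (m+1)` capture all nontrivial factors. -/
theorem stirling_numbers_mod_p_change_of_basis (p : ℕ) (hp : p.Prime) (m a : ℕ) :
    Int.ModEq (p : ℤ)
      ((∏ t ∈ Finset.range (m + 1), ((m / p ^ t) % p).factorial : ℕ) * (a.choose m) : ℤ)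
      (∏ t ∈ Finset.range (m + 1), ∏ s ∈ Finset.range ((m / p ^ t) % p),
        ((a.choose (p ^ t) : ℤ) - (s : ℤ))) := by
  have : Fact p.Prime := ⟨hp⟩
  have lucas := Choose.choose_modEq_choose_mul_prod_range_choose (n := a) (k := m) (p := p) (m + 1)
  rw [Nat.div_eq_of_lt (m.lt_succ_self.trans (Nat.lt_pow_self hp.one_lt)), Nat.choose_zero_right,
    Nat.cast_one, one_mul] at lucas
  refine (lucas.mul_left _).trans ?_
  push_cast
  rw [← Finset.prod_mul_distrib]
  refine Int.ModEq.prod fun t _ => ?_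
  rw [factorial_mul_choose_eq_prod_range_sub]
  exact Int.ModEq.prod fun s _ => (choose_prime_pow_modEq_digit a t).symm.sub_right _
end

section
/- For all natural numbers n and k, the coefficient of the monomial u·v^k in the polynomial (u + v + u·v)^n ∈ ℤ[u,v] equals k+1 if n = k+1, equals k if n = k, and equals 0 otherwise. -/
open MvPolynomial in
/-- The coefficient of `v^k` in `(u + v + u·v)^n` is `1` if `n = k` and `0` otherwise. -/
theorem coeff_vk_of_Gm_comultiplication_power (n k : ℕ) :
    coeff (Finsupp.single (1 : Fin 2) k) ((X 0 + X 1 + X 0 * X 1 : MvPolynomial (Fin 2) ℤ) ^ n)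
      = if n = k then 1 else 0 := by
  induction n generalizing k with
  | zero => simp [coeff_one, eq_comm]
  | succ n ih =>
    rw [pow_succ, mul_add, mul_add, ← mul_assoc, mul_right_comm _ (X 0), coeff_add, coeff_add]
    cases k with
    | zero => simp [coeff_mul_X']
    | succ k =>
      rw [Finsupp.single_add, coeff_mul_X, ih, ← Finsupp.single_add, coeff_mul_X', coeff_mul_X']
      simp

/-- In `ℤ[u,v]` (realized as `MvPolynomial (Fin 2) ℤ` with `u = X 0`,
`v = X 1`), the coefficient of the monomial `u·v^k` in `(u + v + u·v)^n` equals
`k+1` if `n = k+1`, equals `k` if `n = k`, and `0` otherwise. -/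
theorem coeff_uvk_of_Gm_comultiplication_power (n k : ℕ) :
    MvPolynomial.coeff (Finsupp.single (0 : Fin 2) 1 + Finsupp.single (1 : Fin 2) k)
      ((MvPolynomial.X 0 + MvPolynomial.X 1 + MvPolynomial.X 0 * MvPolynomial.X 1 :
          MvPolynomial (Fin 2) ℤ) ^ n)
      = if n = k + 1 then (k + 1 : ℤ) else if n = k then (k : ℤ) else 0 := by
  open MvPolynomial in
  induction n generalizing k with
  | zero =>
    have h : (0 : Fin 2 →₀ ℕ) ≠ Finsupp.single 0 1 + Finsupp.single 1 k := fun h => by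
      simpa using DFunLike.congr_fun h 0
    rw [pow_zero, coeff_one, if_neg h]
    rcases k with _ | k <;> simp
  | succ n ih =>
    rw [pow_succ, mul_add, mul_add, ← mul_assoc, mul_right_comm _ (X 0), coeff_add, coeff_add,
      add_comm (Finsupp.single _ _), coeff_mul_X, coeff_mul_X,
      coeff_vk_of_Gm_comultiplication_power]
    cases k with
    | zero => simp [coeff_mul_X']
    | succ k =>
      have h : Finsupp.single (1 : Fin 2) (k + 1) + Finsupp.single 0 1
          = Finsupp.single 0 1 + Finsupp.single 1 k + Finsupp.single 1 1 := by
        rw [Finsupp.single_add]; abel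
      rw [h, coeff_mul_X, ih, Finsupp.single_add, coeff_mul_X,
        coeff_vk_of_Gm_comultiplication_power]
      push_cast
      split_ifs <;> omega
end

section
/- Let p be a prime, r ∈ ℕ, and m ∈ ℕ whose r-th base-p digit m_r satisfies m_r ≤ p − 2. Then for every j with 0 ≤ j ≤ p^r and m + j ≥ p^r, the multinomial coefficient T(j) := (m+j)! / ( (m+j−p^r)! · j! · (p^r−j)! ) satisfies: T(j) ≡ m_r + 1 (mod p) if j = p^r; T(j) ≡ m_r (mod p) if j = 0; and T(j) ≡ 0 (mod p) if 0 < j < p^r. -/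
/-- The multinomial coefficient `(m+j)! / ((m+j−p^r)!·j!·(p^r−j)!)`. -/
def triMultinomial (p r m j : ℕ) : ℕ :=
  (m + j).factorial / ((m + j - p ^ r).factorial * (j.factorial * (p ^ r - j).factorial))

theorem choose_prime_pow_modEq_div {p : ℕ} (hp : p.Prime) (r n : ℕ) :
    n.choose (p ^ r) ≡ n / p ^ r [MOD p] := by
  have := Fact.mk hp
  induction r generalizing n with
  | zero => simp [Nat.ModEq]
  | succ r ih =>
    have h := Choose.choose_modEq_choose_mod_mul_choose_div_nat (p := p) (n := n) (k := p ^ (r + 1))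
    rw [pow_succ', Nat.mul_mod_right, Nat.choose_zero_right, one_mul,
      Nat.mul_div_cancel_left _ hp.pos] at h
    rw [pow_succ', ← Nat.div_div_eq_div_mul]
    exact h.trans (ih _)

theorem triMultinomial_eq_choose_mul_choose {p r m j : ℕ} (hj : j ≤ p ^ r)
    (hmj : p ^ r ≤ m + j) :
    triMultinomial p r m j = (m + j).choose (p ^ r) * (p ^ r).choose j := by
  unfold triMultinomial
  apply Nat.div_eq_of_eq_mul_left (by positivity)
  rw [← Nat.choose_mul_factorial_mul_factorial hmj, ← Nat.choose_mul_factorial_mul_factorial hj]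
  ring

/-- Let `p` be prime, `r m : ℕ` with the `r`-th base-`p` digit
`m_r = (m / p^r) % p` satisfying `m_r ≤ p − 2`.  Then for every `j` with
`0 ≤ j ≤ p^r` and `m + j ≥ p^r`, the multinomial coefficient
`T(j) := (m+j)! / ((m+j−p^r)!·j!·(p^r−j)!)` satisfies
`T(p^r) ≡ m_r + 1`, `T(0) ≡ m_r`, and `T(j) ≡ 0 (mod p)` for `0 < j < p^r`. -/
theorem T2_distribution_product_structure_constants
    (p : ℕ) (hp : p.Prime) (r m : ℕ) (hm : (m / p ^ r) % p ≤ p - 2)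
    (j : ℕ) (hj : j ≤ p ^ r) (hmj : p ^ r ≤ m + j) :
    (j = p ^ r → Nat.ModEq p (triMultinomial p r m j) ((m / p ^ r) % p + 1)) ∧
    (j = 0 → Nat.ModEq p (triMultinomial p r m j) ((m / p ^ r) % p)) ∧
    (0 < j → j < p ^ r → Nat.ModEq p (triMultinomial p r m j) 0) := by
  rw [triMultinomial_eq_choose_mul_choose hj hmj]
  have hc := choose_prime_pow_modEq_div hp r (m + j)
  refine ⟨?_, ?_, fun h0 h1 => ?_⟩
  · rintro rfl
    rw [Nat.add_div_right _ (pow_pos hp.pos r)] at hc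
    rw [Nat.choose_self, mul_one]
    exact hc.trans ((Nat.mod_modEq _ _).symm.add_right 1)
  · rintro rfl
    rw [Nat.choose_zero_right, mul_one]
    exact hc.trans (Nat.mod_modEq _ _).symm
  · exact (Nat.modEq_zero_iff_dvd).2 ((hp.dvd_choose_pow h0.ne' h1.ne).mul_left _)
end

section
/- Let p be a prime and r ≥ s ≥ 0 natural numbers. For 0 ≤ a ≤ p^r define the integer c_a := C(p^s, p^r − a) − (−1)^{p^r − a} · C(p^s + p^r − a − 1, p^r − a), where C(·,·) is the binomial coefficient. Then modulo p: c_a ≡ 2 if a = p^r − p^s; c_a ≡ (−1)^{k+1} if a = p^r − k·p^s for some integer k with 2 ≤ k ≤ p^{r−s}; and c_a ≡ 0 for all other a in the range (in particular for a = p^r and for all a with p^r − a not a multiple of p^s). -/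
/-- The structure constant of the commutator `[δ_{x^{p^r}}, δ_{y^{p^s}}]` on the basis
element `δ_{x^a y^{p^s}}` in the distribution algebra of the formal completion of `𝕋₂`:
`c_a := C(p^s, p^r − a) − (−1)^{p^r − a} · C(p^s + p^r − a − 1, p^r − a)`. -/
def T2commutatorConstant (p r s a : ℕ) : ℤ :=
  ((p ^ s).choose (p ^ r - a) : ℤ) -
    (-1) ^ (p ^ r - a) * (((p ^ s + p ^ r - a - 1).choose (p ^ r - a) : ℤ))

open Polynomial in
/-- Adding `p ^ s` to the upper index does not change a binomial coefficient modulo `p`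
when the lower index is less than `p ^ s`. -/
theorem ZMod.choose_add_prime_pow (p : ℕ) [Fact p.Prime] (s m j : ℕ) (hj : j < p ^ s) :
    ((m + p ^ s).choose j : ZMod p) = (m.choose j : ZMod p) := by
  have h : ((1 + X : (ZMod p)[X]) ^ (m + p ^ s)) = (1 + X) ^ m + (1 + X) ^ m * X ^ (p ^ s) := by
    rw [pow_add, add_pow_char_pow, one_pow, mul_add, mul_one]
  have h' := congrArg (fun f => coeff f j) h
  simpa [coeff_one_add_X_pow, coeff_mul_X_pow', hj.not_ge] using h'

/-- Modulo `p`, the coefficient of `X ^ n` in `(1 - X) ^ (-p ^ s)` is the indicator of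
`p ^ s ∣ n`. -/
theorem ZMod.choose_prime_pow_add_sub_one (p : ℕ) [Fact p.Prime] (s n : ℕ) :
    ((p ^ s + n - 1).choose n : ZMod p) = if p ^ s ∣ n then 1 else 0 := by
  have hq : 0 < p ^ s := pow_pos (Fact.out : p.Prime).pos s
  have key (n : ℕ) : (p ^ s + n - 1).choose n = (p ^ s + n - 1).choose (p ^ s - 1) :=
    Nat.choose_symm_of_eq_add (by omega)
  induction n using Nat.strong_induction_on with
  | _ n ih =>
    rcases Nat.eq_zero_or_pos n with rfl | hn
    · simp
    rcases lt_or_ge n (p ^ s) with hlt | hge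
    · rw [key, show p ^ s + n - 1 = (n - 1) + p ^ s by omega,
        ZMod.choose_add_prime_pow p s _ _ (by omega), Nat.choose_eq_zero_of_lt (by omega),
        if_neg (Nat.not_dvd_of_pos_of_lt hn hlt), Nat.cast_zero]
    · have h := ih (n - p ^ s) (by omega)
      rw [key, show p ^ s + (n - p ^ s) - 1 = n - 1 by omega] at h
      rw [key, show p ^ s + n - 1 = (n - 1) + p ^ s by omega,
        ZMod.choose_add_prime_pow p s _ _ (by omega), h]
      simp only [Nat.dvd_sub_iff_left hge dvd_rfl]

theorem ZMod.neg_one_pow_prime_pow (p : ℕ) [Fact p.Prime] (s : ℕ) :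
    (-1 : ZMod p) ^ (p ^ s) = -1 :=
  ZMod.pow_card_pow (-1)

theorem T2commutatorConstant_cast (p r s a n : ℕ) [Fact p.Prime] (han : a + n = p ^ r) :
    (T2commutatorConstant p r s a : ZMod p) =
      ((p ^ s).choose n : ZMod p) - (-1) ^ n * (if p ^ s ∣ n then 1 else 0) := by
  rw [← ZMod.choose_prime_pow_add_sub_one]
  simp only [T2commutatorConstant, ← han, Nat.add_sub_cancel_left,
    show p ^ s + (a + n) - a - 1 = p ^ s + n - 1 by omega]
  push_cast
  rfl

/-- Let `p` be prime and `r ≥ s ≥ 0`.  For `0 ≤ a ≤ p^r`, the integers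
`c_a` satisfy, modulo `p`:  `c_a ≡ 2` if `a = p^r − p^s`;  `c_a ≡ (−1)^{k+1}` if
`a = p^r − k·p^s` with `2 ≤ k ≤ p^{r−s}`;  and `c_a ≡ 0` for all other `a` in range
(in particular for `a = p^r` and whenever `p^r − a` is not a multiple of `p^s`). -/
theorem T2_commutator_constants_mod_p
    (p : ℕ) (hp : p.Prime) (r s : ℕ) (hsr : s ≤ r) (a : ℕ) (ha : a ≤ p ^ r) :
    (a + p ^ s = p ^ r → Int.ModEq (p : ℤ) (T2commutatorConstant p r s a) 2) ∧
    (∀ k : ℕ, 2 ≤ k → k ≤ p ^ (r - s) → a + k * p ^ s = p ^ r →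
      Int.ModEq (p : ℤ) (T2commutatorConstant p r s a) ((-1) ^ (k + 1))) ∧
    ((∀ k : ℕ, 1 ≤ k → k ≤ p ^ (r - s) → a + k * p ^ s ≠ p ^ r) →
      Int.ModEq (p : ℤ) (T2commutatorConstant p r s a) 0) := by
  have : Fact p.Prime := ⟨hp⟩
  have hq : 0 < p ^ s := pow_pos hp.pos s
  simp only [← ZMod.intCast_eq_intCast_iff]
  refine ⟨fun h => ?_, fun k hk _ h => ?_, fun h => ?_⟩
  · rw [T2commutatorConstant_cast p r s a _ h, Nat.choose_self, ZMod.neg_one_pow_prime_pow,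
      if_pos dvd_rfl]
    norm_num
  · have hne : k * p ^ s ≠ p ^ s := by nlinarith
    rw [T2commutatorConstant_cast p r s a _ h, if_pos (Dvd.intro_left k rfl), mul_comm k, pow_mul,
      ZMod.neg_one_pow_prime_pow, mul_comm _ k, (ZMod.natCast_eq_zero_iff _ p).2
        (hp.dvd_choose_pow (by positivity) hne)]
    push_cast
    ring
  · obtain ⟨n, hn⟩ := Nat.exists_eq_add_of_le ha
    rw [T2commutatorConstant_cast p r s a n hn.symm]
    rcases Nat.eq_zero_or_pos n with rfl | hpos
    · simp
    have hndvd : ¬ p ^ s ∣ n := by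
      rintro ⟨k, rfl⟩
      refine h k (Nat.pos_of_mul_pos_left hpos) ?_ (by rw [hn, mul_comm])
      refine Nat.le_of_mul_le_mul_left ?_ hq
      rw [← pow_add, Nat.add_sub_cancel' hsr]
      omega
    rw [if_neg hndvd, (ZMod.natCast_eq_zero_iff _ p).2
      (hp.dvd_choose_pow hpos.ne' fun h' => hndvd h'.symm.dvd)]
    simp
end
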